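/- arXiv:2107.01389 — 8 statements merged into one kernel-verified Lean document; each statement's English description precedes it below -/
import Mathlib

section
/- Let E = (E⁰, E¹, d, r) be a topological graph. The maps d₁, r₁ : E₁¹ → E₁⁰ given by d₁(e',e) = (d(e'), e) and r₁(e',e) = (r(e'), e') are well defined (their values lie in E₁⁰), d₁ is a local homeomorphism, and r₁ is continuous. -/
open OnePoint Set Topology

universe u w

variable {V : Type u} {E : Type w} [TopologicalSpace V] [TopologicalSpace E]

/-- `E⁰_fin`: vertices having an open neighborhood whose `r`-preimage is compact. -/
def grFin (r : E → V) : Set V :=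
  {v | ∃ U : Set V, IsOpen U ∧ v ∈ U ∧ IsCompact (r ⁻¹' U)}

/-- `E⁰_sce`: the complement of the closure of the range of `r`. -/
def grSce (r : E → V) : Set V := (closure (Set.range r))ᶜ

/-- `E⁰_rg`: the set of regular vertices. -/
def grRg (r : E → V) : Set V := grFin r \ closure (grSce r)

/-- `E⁰_sg`: the set of singular vertices. -/
def grSg (r : E → V) : Set V := (grRg r)ᶜ

/-- `E¹_rg := d⁻¹(E⁰_rg)`. -/
def grERg (d r : E → V) : Set E := d ⁻¹' grRg r

/-- The vertex space `E₁⁰` of the dual graph. -/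
def dual0 (r : E → V) : Set (V × OnePoint E) :=
  {p | (∀ e : E, p.2 = (e : OnePoint E) → p.1 = r e) ∧ (p.2 = ∞ → p.1 ∈ grSg r)}

/-- The edge space `E₁¹` of the dual graph. -/
def dual1 (d r : E → V) : Set (E × OnePoint E) :=
  {p | (∀ e : E, p.2 = (e : OnePoint E) → d p.1 = r e) ∧ (p.2 = ∞ → p.1 ∉ grERg d r)}

/-- `Ẽ₁⁰ = E₁⁰ ∪ {(∞,∞)}` inside `Ẽ⁰ × Ẽ¹`. -/
def tdual0 (r : E → V) : Set (OnePoint V × OnePoint E) :=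
  (fun p : V × OnePoint E => ((p.1 : OnePoint V), p.2)) '' dual0 r ∪ {((∞ : OnePoint V), (∞ : OnePoint E))}

/-- `Ẽ₁¹ = E₁¹ ∪ {(∞,∞)}` inside `Ẽ¹ × Ẽ¹`. -/
def tdual1 (d r : E → V) : Set (OnePoint E × OnePoint E) :=
  (fun p : E × OnePoint E => ((p.1 : OnePoint E), p.2)) '' dual1 d r ∪ {((∞ : OnePoint E), (∞ : OnePoint E))}

/-- The domain map `d₁ : E₁¹ → E₁⁰`, `d₁(e',e) = (d(e'), e)`. -/
def dualD (d r : E → V) (q : ↥(dual1 d r)) : ↥(dual0 r) :=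
  ⟨(d q.1.1, q.1.2), by
    obtain ⟨h1, h2⟩ := q.2
    exact ⟨h1, fun h0 => h2 h0⟩⟩

/-- The range map `r₁ : E₁¹ → E₁⁰`, `r₁(e',e) = (r(e'), e')`. -/
def dualR (d r : E → V) (q : ↥(dual1 d r)) : ↥(dual0 r) :=
  ⟨(r q.1.1, (q.1.1 : OnePoint E)), by
    refine ⟨fun e he => ?_, fun h0 => absurd h0 (OnePoint.coe_ne_infty _)⟩
    obtain rfl : q.1.1 = e := OnePoint.coe_injective he
    rfl⟩

/-- The chain condition `(e_i, e_{i+1}) ∈ Ẽ₁¹` for a finite tuple. -/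
def chainF (d r : E → V) {n : ℕ} (g : Fin n → OnePoint E) : Prop :=
  ∀ i : ℕ, ∀ h : i + 1 < n, (g ⟨i, by omega⟩, g ⟨i + 1, h⟩) ∈ tdual1 d r

/-- `E_{n+1}⁰`, the vertex space of the `(n+1)`-st iterated dual graph. -/
def iterV (d r : E → V) (n : ℕ) : Set (V × (Fin (n + 1) → OnePoint E)) :=
  {p | (p.1, p.2 ⟨0, by omega⟩) ∈ dual0 r ∧ chainF d r p.2}

/-- `E_{n+1}¹`, the edge space of the `(n+1)`-st iterated dual graph. -/
def iterE (d r : E → V) (n : ℕ) : Set (E × (Fin (n + 1) → OnePoint E)) :=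
  {p | (p.1, p.2 ⟨0, by omega⟩) ∈ dual1 d r ∧ chainF d r p.2}

/-- `Ẽ_{n+1}⁰ = E_{n+1}⁰ ∪ {(∞,…,∞)}`. -/
def titerV (d r : E → V) (n : ℕ) : Set (OnePoint V × (Fin (n + 1) → OnePoint E)) :=
  (fun p : V × (Fin (n + 1) → OnePoint E) => ((p.1 : OnePoint V), p.2)) '' iterV d r n ∪
    {((∞ : OnePoint V), fun _ => ∞)}

/-- `Ẽ_{n+1}¹ = E_{n+1}¹ ∪ {(∞,…,∞)}`. -/
def titerE (d r : E → V) (n : ℕ) : Set (OnePoint E × (Fin (n + 1) → OnePoint E)) :=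
  (fun p : E × (Fin (n + 1) → OnePoint E) => ((p.1 : OnePoint E), p.2)) '' iterE d r n ∪
    {((∞ : OnePoint E), fun _ => ∞)}

/-- The domain map `d_{n+1} : E_{n+1}¹ → E_{n+1}⁰`. -/
def iterD (d r : E → V) (n : ℕ) (q : ↥(iterE d r n)) : ↥(iterV d r n) :=
  ⟨(d q.1.1, q.1.2), by
    obtain ⟨⟨h1, h2⟩, hc⟩ := q.2
    exact ⟨⟨h1, fun h0 => h2 h0⟩, hc⟩⟩

/-- The range map `r_{n+1} : E_{n+1}¹ → E_{n+1}⁰`. -/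
def iterR (d r : E → V) (n : ℕ) (q : ↥(iterE d r n)) : ↥(iterV d r n) :=
  ⟨(r q.1.1, fun i : Fin (n + 1) =>
      Fin.cases ((q.1.1 : OnePoint E)) (fun j : Fin n => q.1.2 j.castSucc) i), by
    obtain ⟨⟨h1, h2⟩, hc⟩ := q.2
    constructor
    · refine ⟨fun e he => ?_, fun h0 => ?_⟩
      · obtain rfl : q.1.1 = e := OnePoint.coe_injective he
        rfl
      · exact absurd h0 (OnePoint.coe_ne_infty _)
    · intro i hilt
      match i, hilt with
      | 0, hilt =>
        exact Or.inl ⟨(q.1.1, q.1.2 ⟨0, by omega⟩), ⟨h1, h2⟩, rfl⟩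
      | (j + 1), hilt =>
        exact hc j (by omega)⟩

/-- Truncation `m⁰_{k,l} : E_{l+1}⁰ → E_{k+1}⁰` (for `k ≤ l`). -/
def iterTrunc (d r : E → V) {k l : ℕ} (h : k ≤ l) (x : ↥(iterV d r l)) : ↥(iterV d r k) :=
  ⟨(x.1.1, fun i : Fin (k + 1) => x.1.2 ⟨(i : ℕ), by have := i.2; omega⟩), by
    obtain ⟨h0, hc⟩ := x.2
    exact ⟨h0, fun i hi => hc i (by omega)⟩⟩

/-- The chain condition `(e_i, e_{i+1}) ∈ Ẽ₁¹` for an infinite sequence. -/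
def chainInf (d r : E → V) (g : ℕ → OnePoint E) : Prop :=
  ∀ i : ℕ, (g i, g (i + 1)) ∈ tdual1 d r

/-- `E∞⁰`, the vertex space of the projective-limit graph. -/
def infV (d r : E → V) : Set (V × (ℕ → OnePoint E)) :=
  {p | (p.1, p.2 0) ∈ dual0 r ∧ chainInf d r p.2}

/-- `E∞¹`, the edge space of the projective-limit graph. -/
def infE (d r : E → V) : Set (E × (ℕ → OnePoint E)) :=
  {p | (p.1, p.2 0) ∈ dual1 d r ∧ chainInf d r p.2}

/-- `Ẽ∞⁰ = E∞⁰ ∪ {(∞,∞,…)}`. -/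
def tinfV (d r : E → V) : Set (OnePoint V × (ℕ → OnePoint E)) :=
  (fun p : V × (ℕ → OnePoint E) => ((p.1 : OnePoint V), p.2)) '' infV d r ∪
    {((∞ : OnePoint V), fun _ => ∞)}

/-- `Ẽ∞¹ = E∞¹ ∪ {(∞,∞,…)}`. -/
def tinfE (d r : E → V) : Set (OnePoint E × (ℕ → OnePoint E)) :=
  (fun p : E × (ℕ → OnePoint E) => ((p.1 : OnePoint E), p.2)) '' infE d r ∪
    {((∞ : OnePoint E), fun _ => ∞)}

/-- The domain map `d∞ : E∞¹ → E∞⁰`. -/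
def infD (d r : E → V) (q : ↥(infE d r)) : ↥(infV d r) :=
  ⟨(d q.1.1, q.1.2), by
    obtain ⟨⟨h1, h2⟩, hc⟩ := q.2
    exact ⟨⟨h1, fun h0 => h2 h0⟩, hc⟩⟩

/-- The range map `r∞ : E∞¹ → E∞⁰`. -/
def infR (d r : E → V) (q : ↥(infE d r)) : ↥(infV d r) :=
  ⟨(r q.1.1, fun i : ℕ => Nat.casesOn i ((q.1.1 : OnePoint E)) (fun j => q.1.2 j)), by
    obtain ⟨⟨h1, h2⟩, hc⟩ := q.2
    constructor
    · refine ⟨fun e he => ?_, fun h0 => ?_⟩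
      · obtain rfl : q.1.1 = e := OnePoint.coe_injective he
        rfl
      · exact absurd h0 (OnePoint.coe_ne_infty _)
    · intro i
      match i with
      | 0 => exact Or.inl ⟨(q.1.1, q.1.2 0), ⟨h1, h2⟩, rfl⟩
      | (j + 1) => exact hc j⟩

/-- Finite paths of length `n+1` ending at a singular vertex: `E^{n+1}_sg`. -/
def finPathSg (d r : E → V) (n : ℕ) : Set (Fin (n + 1) → E) :=
  {g | (∀ i : ℕ, ∀ h : i + 1 < n + 1, d (g ⟨i, by omega⟩) = r (g ⟨i + 1, h⟩)) ∧
    d (g ⟨n, by omega⟩) ∈ grSg r}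

/-- Infinite paths `E^∞`. -/
def infPath (d r : E → V) : Set (ℕ → E) :=
  {g | ∀ i : ℕ, d (g i) = r (g (i + 1))}

/-- The vertex space `E_U⁰` of the relative dual graph. -/
def rdual0 (r : E → V) (U : Set V) : Set (V × OnePoint E) :=
  {p | (∀ e : E, p.2 = (e : OnePoint E) → p.1 = r e) ∧ (p.2 = ∞ → p.1 ∉ U)}

/-- The edge space `E_U¹` of the relative dual graph. -/
def rdual1 (d r : E → V) (U : Set V) : Set (E × OnePoint E) :=
  {p | (∀ e : E, p.2 = (e : OnePoint E) → d p.1 = r e) ∧ (p.2 = ∞ → d p.1 ∉ U)}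

/-- `Ẽ_U⁰ = E_U⁰ ∪ {(∞,∞)}`. -/
def trdual0 (r : E → V) (U : Set V) : Set (OnePoint V × OnePoint E) :=
  (fun p : V × OnePoint E => ((p.1 : OnePoint V), p.2)) '' rdual0 r U ∪
    {((∞ : OnePoint V), (∞ : OnePoint E))}

/-- `Ẽ_U¹ = E_U¹ ∪ {(∞,∞)}`. -/
def trdual1 (d r : E → V) (U : Set V) : Set (OnePoint E × OnePoint E) :=
  (fun p : E × OnePoint E => ((p.1 : OnePoint E), p.2)) '' rdual1 d r U ∪
    {((∞ : OnePoint E), (∞ : OnePoint E))}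

/-- The domain map `d_U : E_U¹ → E_U⁰`. -/
def rdualD (d r : E → V) (U : Set V) (q : ↥(rdual1 d r U)) : ↥(rdual0 r U) :=
  ⟨(d q.1.1, q.1.2), by
    obtain ⟨h1, h2⟩ := q.2
    exact ⟨h1, h2⟩⟩

/-- The range map `r_U : E_U¹ → E_U⁰`. -/
def rdualR (d r : E → V) (U : Set V) (q : ↥(rdual1 d r U)) : ↥(rdual0 r U) :=
  ⟨(r q.1.1, (q.1.1 : OnePoint E)), by
    refine ⟨fun e he => ?_, fun h0 => absurd h0 (OnePoint.coe_ne_infty _)⟩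
    obtain rfl : q.1.1 = e := OnePoint.coe_injective he
    rfl⟩

/-- The restriction of a local homeomorphism to the preimage of an arbitrary set is a local
homeomorphism. -/
theorem IsLocalHomeomorph.restrictPreimage {X Y : Type*} [TopologicalSpace X]
    [TopologicalSpace Y] {f : X → Y} (hf : IsLocalHomeomorph f) (s : Set Y) :
    IsLocalHomeomorph (s.restrictPreimage f) := by
  rw [isLocalHomeomorph_iff_isOpenEmbedding_restrict] at hf ⊢
  intro x
  obtain ⟨U, hU, hfU⟩ := hf x
  let swap : ↥((↑) ⁻¹' U : Set ↥(f ⁻¹' s)) ≃ₜ ↥(U.domRestrict f ⁻¹' s) :=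
    { toFun := fun a => ⟨⟨a.1.1, a.2⟩, a.1.2⟩
      invFun := fun a => ⟨⟨a.1.1, a.2⟩, a.1.2⟩
      left_inv := fun _ => rfl
      right_inv := fun _ => rfl
      continuous_toFun := by fun_prop
      continuous_invFun := by fun_prop }
  exact ⟨_, continuous_subtype_val.continuousAt.preimage_mem_nhds hU,
    (s.restrictPreimage_isOpenEmbedding hfU).comp swap.isOpenEmbedding⟩

/-- The product of a local homeomorphism with an identity map is a local homeomorphism. -/
theorem IsLocalHomeomorph.prodMap_id {X Y : Type*} (Z : Type*) [TopologicalSpace X]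
    [TopologicalSpace Y] [TopologicalSpace Z] {f : X → Y} (hf : IsLocalHomeomorph f) :
    IsLocalHomeomorph (Prod.map f (id : Z → Z)) := by
  intro x
  obtain ⟨e, hx, rfl⟩ := hf x.1
  exact ⟨e.prod (OpenPartialHomeomorph.refl Z), ⟨hx, mem_univ _⟩, rfl⟩

section Statements

variable {V : Type u} {E : Type w}

theorem statement1
    [TopologicalSpace V] [T2Space V] [LocallyCompactSpace V]
    [TopologicalSpace E] [T2Space E] [LocallyCompactSpace E]
    (d r : E → V) (hd : IsLocalHomeomorph d) (hr : Continuous r) :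
    (∀ p : E × OnePoint E, p ∈ dual1 d r →
        (d p.1, p.2) ∈ dual0 r ∧ (r p.1, (p.1 : OnePoint E)) ∈ dual0 r) ∧
    (∀ q : ↥(dual1 d r), (dualD d r q : V × OnePoint E) = (d q.1.1, q.1.2) ∧
        (dualR d r q : V × OnePoint E) = (r q.1.1, (q.1.1 : OnePoint E))) ∧
    IsLocalHomeomorph (dualD d r) ∧ Continuous (dualR d r) := by
  refine ⟨fun p hp => ⟨(dualD d r ⟨p, hp⟩).2, (dualR d r ⟨p, hp⟩).2⟩, fun _ => ⟨rfl, rfl⟩,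
    (hd.prodMap_id (OnePoint E)).restrictPreimage (dual0 r), ?_⟩
  have hfst : Continuous fun q : ↥(dual1 d r) => q.1.1 := by fun_prop
  exact ((hr.comp hfst).prodMk (continuous_coe.comp hfst)).subtype_mk _

end Statements
end

section
/- Let E = (E⁰, E¹, d, r) be a topological graph. The projection m : E₁¹ → E¹, m(e',e) = e', is a proper continuous surjection. -/
open OnePoint Set Topology

universe u w

variable {V : Type u} {E : Type w} [TopologicalSpace V] [TopologicalSpace E]

theorem isOpen_grFin {V : Type u} {E : Type w} [TopologicalSpace V] [TopologicalSpace E]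
    (r : E → V) : IsOpen (grFin r) := by
  refine isOpen_iff_forall_mem_open.2 ?_
  rintro v ⟨U, hU, hv, hK⟩
  exact ⟨U, fun w hw => ⟨U, hU, hw, hK⟩, hU, hv⟩

theorem isOpen_grRg {V : Type u} {E : Type w} [TopologicalSpace V] [TopologicalSpace E]
    (r : E → V) : IsOpen (grRg r) :=
  (isOpen_grFin r).sdiff isClosed_closure

theorem grRg_subset_range {V : Type u} {E : Type w} [TopologicalSpace V] [T2Space V]
    [TopologicalSpace E] {r : E → V} (hr : Continuous r) : grRg r ⊆ range r := by
  rintro v ⟨⟨U, hU, hvU, hK⟩, hv⟩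
  have hcl : v ∈ closure (range r) := by
    by_contra h
    exact hv (subset_closure h)
  by_contra hnr
  have hopen : IsOpen (U \ r '' (r ⁻¹' U)) := hU.sdiff (hK.image hr).isClosed
  obtain ⟨_, ⟨hxU, hx⟩, e, rfl⟩ :=
    mem_closure_iff.1 hcl _ hopen ⟨hvU, fun h => hnr (image_subset_range _ _ h)⟩
  exact hx ⟨e, hxU, rfl⟩

theorem isClosed_dual1 {V : Type u} {E : Type w} [TopologicalSpace V] [T2Space V]
    [TopologicalSpace E] [T2Space E] {d r : E → V} (hd : Continuous d) (hr : Continuous r) :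
    IsClosed (dual1 d r) := by
  rw [← isOpen_compl_iff, isOpen_iff_mem_nhds]
  rintro ⟨a, b⟩ hab
  induction b using OnePoint.rec with
  | infty =>
    have ha : d a ∈ grRg r := by
      by_contra h
      exact hab ⟨fun e he => absurd he.symm (OnePoint.coe_ne_infty e), fun _ => h⟩
    obtain ⟨U, hU, haU, hK⟩ := ha.1
    have hopen : IsOpen ((d ⁻¹' (U ∩ grRg r)) ×ˢ ((↑) '' (r ⁻¹' U) : Set (OnePoint E))ᶜ) :=
      ((hU.inter (isOpen_grRg r)).preimage hd).prod
        (OnePoint.isOpen_compl_image_coe.2 ⟨hK.isClosed, hK⟩)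
    refine Filter.mem_of_superset
      (hopen.mem_nhds ⟨⟨haU, ha⟩, OnePoint.infty_notMem_image_coe⟩) ?_
    rintro ⟨x, y⟩ ⟨⟨hxU, hx⟩, hy⟩ ⟨h1, h2⟩
    induction y using OnePoint.rec with
    | infty => exact h2 rfl hx
    | coe e => exact hy ⟨e, (h1 e rfl ▸ hxU : r e ∈ U), rfl⟩
  | coe e =>
    have hne : d a ≠ r e := fun h =>
      hab ⟨fun e' he => OnePoint.coe_injective he ▸ h, fun h0 => absurd h0 (OnePoint.coe_ne_infty e)⟩
    have hopen : IsOpen {p : E × E | d p.1 ≠ r p.2} :=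
      isOpen_ne_fun (hd.comp continuous_fst) (hr.comp continuous_snd)
    have hemb : IsOpenEmbedding (Prod.map id (↑) : E × E → E × OnePoint E) :=
      IsOpenEmbedding.id.prodMap OnePoint.isOpenEmbedding_coe
    refine Filter.mem_of_superset
      ((hemb.isOpenMap _ hopen).mem_nhds ⟨(a, e), hne, rfl⟩) ?_
    rintro _ ⟨⟨x, y⟩, hxy, rfl⟩ ⟨h1, -⟩
    exact hxy (h1 y rfl)

section Statements

variable {V : Type u} {E : Type w}

theorem statement2
    [TopologicalSpace V] [T2Space V] [LocallyCompactSpace V]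
    [TopologicalSpace E] [T2Space E] [LocallyCompactSpace E]
    (d r : E → V) (hd : IsLocalHomeomorph d) (hr : Continuous r) :
    Continuous (fun q : ↥(dual1 d r) => (q : E × OnePoint E).1) ∧
    Function.Surjective (fun q : ↥(dual1 d r) => (q : E × OnePoint E).1) ∧
    IsProperMap (fun q : ↥(dual1 d r) => (q : E × OnePoint E).1) := by
  have hproper : IsProperMap (fun q : ↥(dual1 d r) => (q : E × OnePoint E).1) :=
    isProperMap_fst_of_compactSpace.comp
      (isClosed_dual1 hd.continuous hr).isClosedEmbedding_subtypeVal.isProperMap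
  refine ⟨hproper.continuous, fun a => ?_, hproper⟩
  by_cases ha : d a ∈ grRg r
  · obtain ⟨e, he⟩ := grRg_subset_range hr ha
    exact ⟨⟨(a, (e : OnePoint E)), fun e' h => OnePoint.coe_injective h ▸ he.symm,
      fun h0 => absurd h0 (OnePoint.coe_ne_infty e)⟩, rfl⟩
  · exact ⟨⟨(a, ∞), fun e h => absurd h.symm (OnePoint.coe_ne_infty e), fun _ => ha⟩, rfl⟩

end Statements
end

section
/- Let E = (E⁰, E¹, d, r) be a topological graph. The map ι : E¹ → E₁⁰, ι(e) = (r(e), e), is a homeomorphism onto the open subset {(v,e) ∈ E₁⁰ | e ≠ ∞} of E₁⁰, its complement {(v,∞) | v ∈ E⁰_sg} is closed in E₁⁰, and the map (v,∞) ↦ v is a homeomorphism from this complement onto E⁰_sg. -/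
open OnePoint Set Topology

universe u w

variable {V : Type u} {E : Type w} [TopologicalSpace V] [TopologicalSpace E]

section Statements

variable {V : Type u} {E : Type w}

/-- The points of the dual vertex space lying over `∞` form a copy of the singular vertices. -/
def dualInftyHomeomorph {V : Type u} {E : Type w} [TopologicalSpace V] [TopologicalSpace E]
    (r : E → V) : {q : ↥(dual0 r) | (q : V × OnePoint E).2 = ∞} ≃ₜ ↥(grSg r) where
  toFun q := ⟨q.1.1.1, q.1.2.2 q.2⟩
  invFun v := ⟨⟨(v.1, ∞), fun e he => absurd he (OnePoint.infty_ne_coe e), fun _ => v.2⟩, rfl⟩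
  left_inv q := Subtype.ext (Subtype.ext (Prod.ext rfl (Eq.symm q.2)))
  right_inv _ := rfl
  continuous_toFun := by fun_prop
  continuous_invFun := by fun_prop

theorem statement3
    [TopologicalSpace V] [T2Space V] [LocallyCompactSpace V]
    [TopologicalSpace E] [T2Space E] [LocallyCompactSpace E]
    (d r : E → V) (hd : IsLocalHomeomorph d) (hr : Continuous r) :
    (∃ ι : E → ↥(dual0 r),
      (∀ e : E, (ι e : V × OnePoint E) = (r e, (e : OnePoint E))) ∧
      Topology.IsOpenEmbedding ι ∧
      Set.range ι = {q : ↥(dual0 r) | (q : V × OnePoint E).2 ≠ ∞}) ∧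
    IsOpen {q : ↥(dual0 r) | (q : V × OnePoint E).2 ≠ ∞} ∧
    IsClosed {q : ↥(dual0 r) | (q : V × OnePoint E).2 = ∞} ∧
    (∃ κ : ↥{q : ↥(dual0 r) | (q : V × OnePoint E).2 = ∞} ≃ₜ ↥(grSg r),
      ∀ q, (κ q : V) = q.1.1.1) := by
  have hcont : Continuous fun q : ↥(dual0 r) => (q : V × OnePoint E).2 := by fun_prop
  have hopen : IsOpen {q : ↥(dual0 r) | (q : V × OnePoint E).2 ≠ ∞} :=
    isOpen_compl_singleton.preimage hcont
  let ι : E → ↥(dual0 r) := fun e => ⟨(r e, (e : OnePoint E)),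
    fun _ he => congrArg r (OnePoint.coe_injective he),
    fun he => absurd he (OnePoint.coe_ne_infty e)⟩
  have hι : Continuous ι := (hr.prodMk OnePoint.continuous_coe).subtype_mk _
  have hrange : Set.range ι = {q : ↥(dual0 r) | (q : V × OnePoint E).2 ≠ ∞} := by
    ext q
    constructor
    · rintro ⟨e, rfl⟩
      exact OnePoint.coe_ne_infty e
    · intro hq
      obtain ⟨e, he⟩ := OnePoint.ne_infty_iff_exists.mp hq
      exact ⟨e, Subtype.ext (Prod.ext (q.2.1 e he.symm).symm he)⟩
  refine ⟨⟨ι, fun _ => rfl, ⟨?_, hrange ▸ hopen⟩, hrange⟩, hopen,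
    isClosed_singleton.preimage hcont, dualInftyHomeomorph r, fun _ => rfl⟩
  exact .of_comp hι hcont OnePoint.isOpenEmbedding_coe.isEmbedding

end Statements
end

section
/- Let E = (E⁰, E¹, d, r) be a topological graph. The maps d∞, r∞ : E∞¹ → E∞⁰ given by d∞(e₀, e₁, e₂, …) = (d(e₀), e₁, e₂, …) and r∞(e₀, e₁, e₂, …) = (r(e₀), e₀, e₁, …) are well defined (their values lie in E∞⁰), d∞ is a local homeomorphism, and r∞ is continuous. -/
open OnePoint Set Topology

universe u w

variable {V : Type u} {E : Type w} [TopologicalSpace V] [TopologicalSpace E]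

theorem IsLocalHomeomorph.prodMap {X Y X' Y' : Type*} [TopologicalSpace X] [TopologicalSpace Y]
    [TopologicalSpace X'] [TopologicalSpace Y'] {f : X → Y} {g : X' → Y'}
    (hf : IsLocalHomeomorph f) (hg : IsLocalHomeomorph g) : IsLocalHomeomorph (Prod.map f g) := by
  rintro ⟨x, y⟩
  obtain ⟨e, hx, rfl⟩ := hf x
  obtain ⟨e', hy, rfl⟩ := hg y
  exact ⟨e.prod e', ⟨hx, hy⟩, rfl⟩

section Statements

variable {V : Type u} {E : Type w}

theorem statement10
    [TopologicalSpace V] [T2Space V] [LocallyCompactSpace V]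
    [TopologicalSpace E] [T2Space E] [LocallyCompactSpace E]
    (d r : E → V) (hd : IsLocalHomeomorph d) (hr : Continuous r) :
    (∀ p : E × (ℕ → OnePoint E), p ∈ infE d r →
        (d p.1, p.2) ∈ infV d r ∧
        (r p.1, fun i : ℕ => Nat.casesOn i ((p.1 : OnePoint E)) (fun j => p.2 j)) ∈ infV d r) ∧
    (∀ q : ↥(infE d r),
        (infD d r q : V × (ℕ → OnePoint E)) = (d q.1.1, q.1.2) ∧
        (infR d r q : V × (ℕ → OnePoint E)) =
          (r q.1.1, fun i : ℕ => Nat.casesOn i ((q.1.1 : OnePoint E)) (fun j => q.1.2 j))) ∧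
    IsLocalHomeomorph (infD d r) ∧ Continuous (infR d r) := by
  refine ⟨fun p hp => ⟨(infD d r ⟨p, hp⟩).2, (infR d r ⟨p, hp⟩).2⟩, fun q => ⟨rfl, rfl⟩,
    (hd.prodMap (Homeomorph.refl _).isLocalHomeomorph).restrictPreimage (infV d r), ?_⟩
  refine Continuous.subtype_mk (.prodMk (hr.comp (by fun_prop)) (continuous_pi fun i => ?_)) _
  cases i with
  | zero => exact OnePoint.continuous_coe.comp (by fun_prop)
  | succ j => exact (continuous_apply j).comp (by fun_prop)

end Statements
end

section
/- Let E = (E⁰, E¹, d, r) be a topological graph. The map r∞ : E∞¹ → E∞⁰, r∞(e₀, e₁, e₂, …) = (r(e₀), e₀, e₁, …), is a homeomorphism onto the open subset {(v, e₁, e₂, …) ∈ E∞⁰ | e₁ ≠ ∞} of E∞⁰. In particular, the topological graph E∞ = (E∞⁰, E∞¹, d∞, r∞) is a singly generated dynamical system. -/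
open OnePoint Set Topology

universe u w

variable {V : Type u} {E : Type w} [TopologicalSpace V] [TopologicalSpace E]

theorem continuous_infR {d r : E → V} (hr : Continuous r) : Continuous (infR d r) := by
  refine Continuous.subtype_mk (Continuous.prodMk (by fun_prop) (continuous_pi fun i => ?_)) _
  cases i with
  | zero => exact OnePoint.continuous_coe.comp (continuous_fst.comp continuous_subtype_val)
  | succ j => exact (continuous_apply j).comp (continuous_snd.comp continuous_subtype_val)

theorem isEmbedding_infR {d r : E → V} (hr : Continuous r) : IsEmbedding (infR d r) := by
  let s : ↥(infV d r) → OnePoint E × (ℕ → OnePoint E) :=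
    fun x => (x.1.2 0, fun j => x.1.2 (j + 1))
  have hs : Continuous s := by fun_prop
  exact .of_comp (continuous_infR hr) hs
    ((OnePoint.isOpenEmbedding_coe.isEmbedding.prodMap .id).comp .subtypeVal)

theorem range_infR (d r : E → V) :
    Set.range (infR d r) = {q : ↥(infV d r) | (q : V × (ℕ → OnePoint E)).2 0 ≠ ∞} := by
  ext q
  constructor
  · rintro ⟨p, rfl⟩
    exact OnePoint.coe_ne_infty _
  · obtain ⟨⟨v, g⟩, hv, hg⟩ := q
    intro h
    obtain ⟨e, he⟩ := OnePoint.ne_infty_iff_exists.mp h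
    have hge : g 0 = (e : OnePoint E) := he.symm
    have hve : v = r e := hv.1 e hge
    have hd : (e, g 1) ∈ dual1 d r := by
      rcases hg 0 with ⟨⟨e', x⟩, hx, hxe⟩ | h0
      · obtain ⟨h1, h2⟩ := Prod.mk.inj hxe
        obtain rfl : e' = e := OnePoint.coe_injective (h1.trans hge)
        obtain rfl : x = g 1 := h2
        exact hx
      · exact absurd (Prod.mk.inj h0).1 h
    refine ⟨⟨(e, fun j => g (j + 1)), hd, fun i => hg (i + 1)⟩, Subtype.ext ?_⟩
    refine Prod.ext hve.symm (funext fun i => ?_)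
    cases i with
    | zero => exact he
    | succ j => rfl

section Statements

variable {V : Type u} {E : Type w}

theorem statement11
    [TopologicalSpace V] [T2Space V] [LocallyCompactSpace V]
    [TopologicalSpace E] [T2Space E] [LocallyCompactSpace E]
    (d r : E → V) (hd : IsLocalHomeomorph d) (hr : Continuous r) :
    Topology.IsOpenEmbedding (infR d r) ∧
    Set.range (infR d r) = {q : ↥(infV d r) | (q : V × (ℕ → OnePoint E)).2 0 ≠ ∞} := by
  refine ⟨⟨isEmbedding_infR hr, ?_⟩, range_infR d r⟩
  rw [range_infR]
  exact isOpen_compl_singleton.preimage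
    ((continuous_apply 0).comp (continuous_snd.comp continuous_subtype_val))

end Statements
end

section
/- Let E = (E⁰, E¹, d, r) be a topological graph. The maps sending v ∈ E⁰_sg to (v, ∞, ∞, …), sending a finite path (e₁, …, e_n) ∈ E^n_sg (n ≥ 1) to (r(e₁), e₁, …, e_n, ∞, ∞, …), and sending an infinite path (e₁, e₂, …) ∈ E^∞ to (r(e₁), e₁, e₂, …) together define a bijection from the disjoint union E⁰_sg ⊔ (⊔_{n≥1} E^n_sg) ⊔ E^∞ onto the set E∞⁰. -/
open OnePoint Set Topology

universe u w

variable {V : Type u} {E : Type w} [TopologicalSpace V] [TopologicalSpace E]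

section Statements

variable {V : Type u} {E : Type w}

theorem coe_coe_mem_tdual1 [TopologicalSpace V] [TopologicalSpace E] {d r : E → V} {a b : E} :
    ((a : OnePoint E), (b : OnePoint E)) ∈ tdual1 d r ↔ d a = r b := by
  simp [tdual1, dual1]

theorem coe_infty_mem_tdual1 [TopologicalSpace V] [TopologicalSpace E] {d r : E → V} {a : E} :
    ((a : OnePoint E), (∞ : OnePoint E)) ∈ tdual1 d r ↔ d a ∈ grSg r := by
  simp [tdual1, dual1, grSg, grERg]

theorem infty_mem_tdual1 [TopologicalSpace V] [TopologicalSpace E] {d r : E → V}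
    {x : OnePoint E} : ((∞ : OnePoint E), x) ∈ tdual1 d r ↔ x = ∞ := by
  simp [tdual1]

theorem coe_mem_dual0 [TopologicalSpace V] [TopologicalSpace E] {r : E → V} {v : V} {e : E} :
    (v, (e : OnePoint E)) ∈ dual0 r ↔ v = r e := by
  simp [dual0]

theorem infty_mem_dual0 [TopologicalSpace V] [TopologicalSpace E] {r : E → V} {v : V} :
    (v, (∞ : OnePoint E)) ∈ dual0 r ↔ v ∈ grSg r := by
  simp [dual0]

theorem chainInf.eq_infty_of_le [TopologicalSpace V] [TopologicalSpace E] {d r : E → V}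
    {g : ℕ → OnePoint E} (hg : chainInf d r g) {m n : ℕ} (hmn : m ≤ n) (hm : g m = ∞) :
    g n = ∞ := by
  induction n, hmn using Nat.le_induction with
  | base => exact hm
  | succ k _ ih =>
    have h := hg k
    rw [ih] at h
    exact infty_mem_tdual1.1 h

theorem statement15
    [TopologicalSpace V] [T2Space V] [LocallyCompactSpace V]
    [TopologicalSpace E] [T2Space E] [LocallyCompactSpace E]
    (d r : E → V) (hd : IsLocalHomeomorph d) (hr : Continuous r) :
    Set.BijOn
      (Sum.elim
        (fun v : ↥(grSg r) => (((v : V), fun _ : ℕ => (∞ : OnePoint E)) : V × (ℕ → OnePoint E)))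
        (Sum.elim
          (fun x : Σ n : ℕ, ↥(finPathSg d r n) =>
            ((r (x.2.1 ⟨0, by omega⟩),
              fun i : ℕ => if h : i < x.1 + 1 then ((x.2.1 ⟨i, h⟩ : E) : OnePoint E) else ∞) :
              V × (ℕ → OnePoint E)))
          (fun g : ↥(infPath d r) =>
            ((r (g.1 0), fun i : ℕ => ((g.1 i : E) : OnePoint E)) : V × (ℕ → OnePoint E)))))
      Set.univ (infV d r) := by
  refine ⟨?_, ?_, ?_⟩
  · rintro (⟨v, hv⟩ | ⟨n, g, hg, hsg⟩ | ⟨g, hg⟩) -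
    · exact ⟨infty_mem_dual0.2 hv, fun _ => infty_mem_tdual1.2 rfl⟩
    · refine ⟨?_, fun i => ?_⟩
      · simp [coe_mem_dual0]
      · rcases lt_trichotomy i n with h | rfl | h
        · have h1 : i < n + 1 := by omega
          have h2 : i + 1 < n + 1 := by omega
          simpa only [Sum.elim_inr, Sum.elim_inl, dif_pos h1, dif_pos h2, coe_coe_mem_tdual1]
            using hg i h2
        · have h1 : i < i + 1 := by omega
          have h2 : ¬ i + 1 < i + 1 := by omega
          simpa only [Sum.elim_inr, Sum.elim_inl, dif_pos h1, dif_neg h2, coe_infty_mem_tdual1]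
            using hsg
        · have h1 : ¬ i < n + 1 := by omega
          have h2 : ¬ i + 1 < n + 1 := by omega
          simp only [Sum.elim_inr, Sum.elim_inl, dif_neg h1, dif_neg h2, infty_mem_tdual1]
    · exact ⟨coe_mem_dual0.2 rfl, fun i => coe_coe_mem_tdual1.2 (hg i)⟩
  · rintro (⟨v, hv⟩ | ⟨n, g, hg⟩ | ⟨g, hg⟩) - (⟨w, hw⟩ | ⟨m, k, hk⟩ | ⟨k, hk⟩) - h <;>
      simp only [Sum.elim_inr, Sum.elim_inl, Prod.mk.injEq] at h <;>
      obtain ⟨h0, h⟩ := h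
    · subst h0
      rfl
    · simpa using congrFun h 0
    · simpa using congrFun h 0
    · simpa using congrFun h 0
    · obtain rfl : n = m := by
        rcases lt_trichotomy n m with hlt | heq | hlt
        · have := congrFun h m
          simp [show ¬ m < n + 1 by omega] at this
        · exact heq
        · have := congrFun h n
          simp [show ¬ n < m + 1 by omega] at this
      obtain rfl : g = k := by
        funext i
        have := congrFun h i
        simpa only [dif_pos i.2, OnePoint.coe_eq_coe] using this
      rfl
    · simpa using congrFun h (n + 1)
    · simpa using congrFun h 0
    · simpa using congrFun h (m + 1)
    · obtain rfl : g = k := funext fun i => OnePoint.coe_injective (congrFun h i)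
      rfl
  · rintro ⟨v, x⟩ ⟨h0, hx⟩
    dsimp only at h0 hx
    by_cases hfin : ∃ n, x n = ∞
    · classical
      obtain ⟨N, hN, hmin⟩ : ∃ N, x N = ∞ ∧ ∀ i < N, x i ≠ ∞ :=
        ⟨Nat.find hfin, Nat.find_spec hfin, fun i hi => Nat.find_min hfin hi⟩
      cases N with
      | zero =>
        rw [hN] at h0
        refine ⟨Sum.inl ⟨v, infty_mem_dual0.1 h0⟩, mem_univ _, Prod.ext rfl ?_⟩
        funext i
        exact (hx.eq_infty_of_le (Nat.zero_le i) hN).symm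
      | succ n =>
        have hlift : ∀ i : Fin (n + 1), ∃ e : E, (e : OnePoint E) = x i := fun i =>
          OnePoint.ne_infty_iff_exists.1 (hmin i i.2)
        choose g hg using hlift
        refine ⟨Sum.inr (Sum.inl ⟨n, g, fun i hi => ?_, ?_⟩), mem_univ _, Prod.ext ?_ ?_⟩
        · have h := hx i
          rw [← hg ⟨i, by omega⟩, ← hg ⟨i + 1, hi⟩] at h
          exact coe_coe_mem_tdual1.1 h
        · have h := hx n
          rw [← hg ⟨n, by omega⟩, hN] at h
          exact coe_infty_mem_tdual1.1 h
        · rw [← hg ⟨0, by omega⟩] at h0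
          exact (coe_mem_dual0.1 h0).symm
        · funext i
          by_cases hi : i < n + 1
          · simpa only [Sum.elim_inr, Sum.elim_inl, dif_pos hi] using hg ⟨i, hi⟩
          · simpa only [Sum.elim_inr, Sum.elim_inl, dif_neg hi] using
              (hx.eq_infty_of_le (not_lt.1 hi) hN).symm
    · push Not at hfin
      choose g hg using fun i => OnePoint.ne_infty_iff_exists.1 (hfin i)
      obtain rfl : (fun i => (g i : OnePoint E)) = x := funext hg
      exact ⟨Sum.inr (Sum.inr ⟨g, fun i => coe_coe_mem_tdual1.1 (hx i)⟩), mem_univ _,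
        Prod.ext (coe_mem_dual0.1 h0).symm rfl⟩

end Statements
end

section
/- Let E⁰ and E¹ be locally compact Hausdorff spaces, dom(r) an open subset of E¹, and r : dom(r) → E⁰ a continuous map. The following conditions are equivalent: (i) for every compact subset X of E⁰, r⁻¹(X) is closed in E¹; (ii) the map tr : E¹ → Ẽ⁰ defined by tr(e) = r(e) for e ∈ dom(r) and tr(e) = ∞ for e ∉ dom(r) is continuous; (iii) there exist a locally compact Hausdorff space U, an open embedding j : E⁰ → U, and a continuous map s : E¹ → U such that s⁻¹(j(E⁰)) = dom(r) and s(e) = j(r(e)) for all e ∈ dom(r); (iv) for every continuous function f : E⁰ → ℂ vanishing at infinity, the function F : E¹ → ℂ defined by F(e) = f(r(e)) for e ∈ dom(r) and F(e) = 0 for e ∉ dom(r) is continuous. -/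
open OnePoint Set Topology

universe u w

variable {V : Type u} {E : Type w} [TopologicalSpace V] [TopologicalSpace E]

section Statements

variable {V : Type u} {E : Type w}

/-- In a locally compact Hausdorff space, a compact set can be separated from the complement of
an open set containing it by a complex-valued function vanishing at infinity. -/
lemma exists_continuous_complex_one_zero_of_isCompact
    [TopologicalSpace V] [T2Space V] [LocallyCompactSpace V]
    {K C : Set V} (hK : IsCompact K) (hC : IsClosed C) (hKC : Disjoint K C) :
    ∃ f : V → ℂ, Continuous f ∧ Filter.Tendsto f (Filter.cocompact V) (𝓝 0) ∧
      EqOn f 1 K ∧ EqOn f 0 C := by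
  obtain ⟨g, hgK, hgC, hg, -⟩ := exists_continuous_one_zero_of_isCompact hK hC hKC
  refine ⟨fun v => (g v : ℂ), by fun_prop, ?_, fun v hv => ?_, fun v hv => ?_⟩
  · simpa [Function.comp_def] using
      (Complex.continuous_ofReal.tendsto 0).comp hg.is_zero_at_infty
  · simp [hgK hv]
  · simp [hgC hv]

open scoped Classical in
/-- Extending a continuous map on an open set by `∞` gives a continuous map into the one-point
compactification as soon as preimages of compact sets are closed. -/
lemma continuous_dite_infty [TopologicalSpace V] [T2Space V] [TopologicalSpace E]
    {dom : Set E} (hdom : IsOpen dom) {r : ↥dom → V} (hr : Continuous r)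
    (h : ∀ K : Set V, IsCompact K → IsClosed {e : E | ∃ h : e ∈ dom, r ⟨e, h⟩ ∈ K}) :
    Continuous (fun e : E => if h : e ∈ dom then ((r ⟨e, h⟩ : V) : OnePoint V) else ∞) := by
  refine continuous_def.2 fun s hs => ?_
  by_cases hmem : ∞ ∈ s
  · rw [← isClosed_compl_iff]
    convert h _ ((OnePoint.isOpen_iff_of_mem hmem).1 hs).2 using 1
    ext e
    by_cases he : e ∈ dom <;> simp [he, hmem]
  · convert hdom.isOpenMap_subtype_val _
      (((OnePoint.isOpen_iff_of_notMem hmem).1 hs).preimage hr) using 1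
    ext e
    by_cases he : e ∈ dom <;> simp [he, hmem]

open scoped Classical in
/-- Preimages of compact sets are closed if the extensions by zero of all functions vanishing at
infinity are continuous. -/
lemma isClosed_preimage_of_continuous_dite_zero
    [TopologicalSpace V] [T2Space V] [LocallyCompactSpace V] [TopologicalSpace E]
    {dom : Set E} {r : ↥dom → V}
    (h : ∀ f : V → ℂ, Continuous f → Filter.Tendsto f (Filter.cocompact V) (𝓝 0) →
      Continuous (fun e : E => if h : e ∈ dom then f (r ⟨e, h⟩) else 0))
    {K : Set V} (hK : IsCompact K) : IsClosed {e : E | ∃ h : e ∈ dom, r ⟨e, h⟩ ∈ K} := by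
  rw [← isOpen_compl_iff, isOpen_iff_mem_nhds]
  intro e₀ he₀
  obtain ⟨f, hf, hf0, hfK, hfC⟩ := exists_continuous_complex_one_zero_of_isCompact hK
    (C := {v | ∃ h : e₀ ∈ dom, r ⟨e₀, h⟩ = v})
    (by
      by_cases h₀ : e₀ ∈ dom
      · simp [h₀]
      · simp [h₀])
    (Set.disjoint_left.2 fun v hv ⟨h₀, hv'⟩ => he₀ ⟨h₀, hv' ▸ hv⟩)
  have hF₀ : (if h : e₀ ∈ dom then f (r ⟨e₀, h⟩) else 0) ≠ 1 := by
    split_ifs with h₀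
    · simp [hfC ⟨h₀, rfl⟩]
    · simp
  filter_upwards [(h f hf hf0).continuousAt.eventually_ne hF₀] with e he ⟨hed, heK⟩
  exact he (by simp [hed, hfK heK])

open scoped Classical in
theorem statement16
    [TopologicalSpace V] [T2Space V] [LocallyCompactSpace V]
    [TopologicalSpace E] [T2Space E] [LocallyCompactSpace E]
    (dom : Set E) (hdom : IsOpen dom) (r : ↥dom → V) (hr : Continuous r) :
    List.TFAE
      [∀ K : Set V, IsCompact K → IsClosed {e : E | ∃ h : e ∈ dom, r ⟨e, h⟩ ∈ K},
       Continuous (fun e : E => if h : e ∈ dom then ((r ⟨e, h⟩ : V) : OnePoint V) else ∞),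
       ∃ (U : Type u) (_i : TopologicalSpace U), @T2Space U _i ∧ @LocallyCompactSpace U _i ∧
         ∃ (j : V → U) (s : E → U),
           @Topology.IsOpenEmbedding V U _ _i j ∧ @Continuous E U _ _i s ∧
           s ⁻¹' (Set.range j) = dom ∧ ∀ (e : E) (h : e ∈ dom), s e = j (r ⟨e, h⟩),
       ∀ f : V → ℂ, Continuous f → Filter.Tendsto f (Filter.cocompact V) (nhds 0) →
         Continuous (fun e : E => if h : e ∈ dom then f (r ⟨e, h⟩) else 0)] := by
  tfae_have 1 → 2 := continuous_dite_infty hdom hr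
  tfae_have 2 → 3 := fun h =>
    ⟨OnePoint V, inferInstance, inferInstance, inferInstance, (↑), _,
      OnePoint.isOpenEmbedding_coe, h, by
        ext e
        by_cases he : e ∈ dom <;> simp [he], fun e he => by simp [he]⟩
  tfae_have 3 → 1 := by
    rintro ⟨U, _, _, _, j, s, hj, hs, hdom_eq, hsj⟩ K hK
    convert ((hK.image hj.continuous).isClosed).preimage hs using 1
    ext e
    constructor
    · rintro ⟨he, heK⟩
      exact ⟨_, heK, (hsj e he).symm⟩
    · rintro ⟨v, hv, hve⟩
      have he : e ∈ dom := hdom_eq ▸ ⟨v, hve⟩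
      refine ⟨he, ?_⟩
      rwa [← hj.injective (hve.trans (hsj e he))]
  tfae_have 2 → 4 := by
    intro h f hf hf0
    have hext : Continuous fun x : OnePoint V => x.elim 0 f :=
      (OnePoint.continuous_iff _).2 ⟨by simpa [Filter.coclosedCompact_eq_cocompact] using hf0, hf⟩
    convert hext.comp h using 1
    ext e
    by_cases he : e ∈ dom <;> simp [he]
  tfae_have 4 → 1 := fun h K hK => isClosed_preimage_of_continuous_dite_zero h hK
  tfae_finish

end Statements
end

section
/- Let E = (E⁰, E¹, d, r) be a partially defined topological graph with dom(r) ≠ E¹, and let tE = (Ẽ⁰, E¹, d, tr) be the associated topological graph. If the space Y := {(v,e) ∈ Ẽ⁰ × Ẽ¹ | if e ∈ E¹ then v = tr(e), and if e = ∞ then v ∈ E⁰ \ (tE⁰)_rg} (with the subspace topology of Ẽ⁰ × Ẽ¹) is compact, then the point ∞ ∈ Ẽ⁰ is a regular vertex of tE, i.e. ∞ ∈ (tE⁰)_rg. -/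
open OnePoint Set Topology

universe u w

variable {V : Type u} {E : Type w} [TopologicalSpace V] [TopologicalSpace E]

section RegularVertices

variable {X : Type*} {E : Type*} [TopologicalSpace X] [TopologicalSpace E]

/-- If `U` is open, the preimage of
`closure U` is compact and `frontier U` is contained in `grFin r`, then so is `U`. -/
theorem subset_grFin_of_frontier_subset [CompactSpace X] {r : E → X} {U : Set X}
    (hU : IsOpen U) (hc : IsCompact (r ⁻¹' closure U)) (hf : frontier U ⊆ grFin r) :
    U ⊆ grFin r := by
  intro x hx
  obtain ⟨W, hWo, hfW, hWc⟩ : ∃ W, IsOpen W ∧ frontier U ⊆ W ∧ IsCompact (r ⁻¹' W) := by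
    refine isClosed_frontier.isCompact.induction_on
      (p := fun s => ∃ W, IsOpen W ∧ s ⊆ W ∧ IsCompact (r ⁻¹' W)) ?_ ?_ ?_ ?_
    · exact ⟨∅, isOpen_empty, Subset.rfl, by simp⟩
    · rintro s t hst ⟨W, hWo, hW, hWc⟩
      exact ⟨W, hWo, hst.trans hW, hWc⟩
    · rintro s t ⟨W, hWo, hW, hWc⟩ ⟨W', hWo', hW', hWc'⟩
      exact ⟨W ∪ W', hWo.union hWo', union_subset_union hW hW', hWc.union hWc'⟩
    · intro y hy
      obtain ⟨W, hWo, hyW, hWc⟩ := hf hy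
      exact ⟨W, mem_nhdsWithin_of_mem_nhds (hWo.mem_nhds hyW), W, hWo, Subset.rfl, hWc⟩
  refine ⟨U ∪ W, hU.union hWo, Or.inl hx, ?_⟩
  have hUW : U ∪ W = closure U ∪ W := by
    rw [closure_eq_self_union_frontier, union_assoc, union_eq_self_of_subset_left hfW]
  rw [hUW, preimage_union]
  exact hc.union hWc

/-- A vertex in the range of `r` is regular if it has an open neighborhood `U` that is otherwise
made of regular vertices and whose preimage is relatively compact. -/
theorem mem_grRg_of_punctured_nhds [CompactSpace X] [T2Space X] {r : E → X}
    (hr : Continuous r) {x : X} (hx : x ∈ range r) {U : Set X} (hU : IsOpen U) (hxU : x ∈ U)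
    {K : Set E} (hK : IsCompact K) (hUK : r ⁻¹' U ⊆ K)
    (hreg : ∀ y ∈ U, y ≠ x → y ∈ grRg r) : x ∈ grRg r := by
  constructor
  · obtain ⟨T, hT, hTc, hTU⟩ := exists_mem_nhds_isClosed_subset (hU.mem_nhds hxU)
    have hcl : closure (interior T) ⊆ U :=
      (closure_minimal interior_subset hTc).trans hTU
    have hxT : x ∈ interior T := mem_interior_iff_mem_nhds.2 hT
    refine subset_grFin_of_frontier_subset isOpen_interior
      (hK.of_isClosed_subset (isClosed_closure.preimage hr) ((preimage_mono hcl).trans hUK))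
      (fun y hy => (hreg y (hcl (frontier_subset_closure hy)) ?_).1) hxT
    rintro rfl
    exact (isOpen_interior.frontier_eq.subset hy).2 hxT
  · intro hcl
    obtain ⟨y, hyU, hy⟩ := mem_closure_iff.1 hcl U hU hxU
    by_cases hyx : y = x
    · subst hyx
      exact hy (subset_closure hx)
    · exact (hreg y hyU hyx).2 (subset_closure hy)

end RegularVertices

section Statements

variable {V : Type u} {E : Type w}

open scoped Classical in
theorem statement19
    [TopologicalSpace V] [T2Space V] [LocallyCompactSpace V]
    [TopologicalSpace E] [T2Space E] [LocallyCompactSpace E]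
    (d : E → V) (hd : IsLocalHomeomorph d)
    (dom : Set E) (hdom : IsOpen dom) (hne : dom ≠ Set.univ)
    (r : ↥dom → V) (hr : Continuous r)
    (tr : E → OnePoint V)
    (htr : tr = fun e => if h : e ∈ dom then ((r ⟨e, h⟩ : V) : OnePoint V) else ∞)
    (htrc : Continuous tr)
    (Y : Set (OnePoint V × OnePoint E))
    (hY : Y = {p | (∀ e : E, p.2 = (e : OnePoint E) → p.1 = tr e) ∧
        (p.2 = ∞ → (∃ w : V, p.1 = (w : OnePoint V)) ∧ p.1 ∉ grRg tr)})
    (hcpt : IsCompact Y) :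
    ∞ ∈ grRg tr := by
  have hinf : (∞ : OnePoint V) ∈ range tr := by
    obtain ⟨e, he⟩ := (ne_univ_iff_exists_notMem dom).1 hne
    exact ⟨e, by simp [htr, he]⟩
  have hnot : ((∞, ∞) : OnePoint V × OnePoint E) ∈ Yᶜ := by
    rw [hY]
    rintro ⟨-, h⟩
    obtain ⟨⟨w, hw⟩, -⟩ := h rfl
    exact infty_ne_coe w hw
  obtain ⟨U, W, hU, hW, hUi, hWi, hUW⟩ :=
    isOpen_prod_iff.1 hcpt.isClosed.isOpen_compl _ _ hnot
  have hK : IsCompact ((↑) ⁻¹' W : Set E)ᶜ := ((isOpen_iff_of_mem hWi).1 hW).2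
  refine mem_grRg_of_punctured_nhds htrc hinf hU hUi hK (fun e he heW => ?_) fun y hy hyi => ?_
  · refine hUW (mk_mem_prod he heW) ?_
    rw [hY]
    refine ⟨fun e' h => ?_, fun h => absurd h (coe_ne_infty e)⟩
    rw [coe_injective h]
  · by_contra hyr
    refine hUW (mk_mem_prod hy hWi) ?_
    rw [hY]
    exact ⟨fun e h => absurd h (infty_ne_coe e), fun _ => ⟨(ne_infty_iff_exists.1 hyi).imp
      fun _ => Eq.symm, hyr⟩⟩

end Statements
end
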